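/- Let n ≥ 2 and let D be a torsion-free affine connection on ℝⁿ preserving a volume form, with ambient metric 𝐠 on Ω = ℝ_{>0} × ℝⁿ × ℝⁿ × ℝ. Then the vector field 𝐤 = 2 ∑_A p_A ∂_{p_A} + 2ρ ∂_ρ is a homothety of degree 2 of 𝐠: the Lie derivative satisfies (L_𝐤 𝐠)_{ij} = 2 𝐠_{ij} at every point of Ω and for all indices i, j. -/

import Mathlib

open scoped BigOperators

/-- Partial derivative of a function on `ι → ℝ` in coordinate direction `i`. -/
noncomputable def pd {ι : Type} [Fintype ι] [DecidableEq ι] (i : ι)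
    (f : (ι → ℝ) → ℝ) (x : ι → ℝ) : ℝ :=
  fderiv ℝ f x (Pi.single i 1)

/-- Ricci curvature of an affine connection given by coefficients `Γ k i j`. -/
noncomputable def ricConn {ι : Type} [Fintype ι] [DecidableEq ι]
    (Γ : ι → ι → ι → (ι → ℝ) → ℝ) (i j : ι) (x : ι → ℝ) : ℝ :=
  (∑ k, pd k (fun y => Γ k i j y) x) - (∑ k, pd i (fun y => Γ k k j y) x)
    + ∑ k, ∑ l, (Γ k k l x * Γ l i j x - Γ k i l x * Γ l k j x)

/-- Levi-Civita Christoffel symbols of a metric in coordinates. -/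
noncomputable def christoffel {ι : Type} [Fintype ι] [DecidableEq ι]
    (G : (ι → ℝ) → Matrix ι ι ℝ) (k i j : ι) (x : ι → ℝ) : ℝ :=
  (1/2) * ∑ l, (G x)⁻¹ k l *
    (pd i (fun y => G y j l) x + pd j (fun y => G y i l) x - pd l (fun y => G y i j) x)

/-- Laplacian of a metric in coordinates, applied to a function. -/
noncomputable def laplacian {ι : Type} [Fintype ι] [DecidableEq ι]
    (G : (ι → ℝ) → Matrix ι ι ℝ) (F : (ι → ℝ) → ℝ) (x : ι → ℝ) : ℝ :=
  ∑ i, ∑ j, (G x)⁻¹ i j *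
    (pd i (fun y => pd j F y) x - ∑ k, christoffel G k i j x * pd k F x)

/-- Lie derivative of a metric along a vector field, in coordinates. -/
noncomputable def lieDeriv {ι : Type} [Fintype ι] [DecidableEq ι]
    (X : ι → (ι → ℝ) → ℝ) (G : (ι → ℝ) → Matrix ι ι ℝ) (i j : ι) (x : ι → ℝ) : ℝ :=
  (∑ k, X k x * pd k (fun y => G y i j) x)
  + (∑ k, pd i (X k) x * G x k j) + ∑ k, pd j (X k) x * G x i k

/-- Index type for the ambient space: `t`, `x^A`, `p_A`, `ρ`. -/
abbrev AmbIdx (n : ℕ) : Type := Unit ⊕ (Fin n ⊕ (Fin n ⊕ Unit))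

def it (n : ℕ) : AmbIdx n := Sum.inl ()
def ix {n : ℕ} (A : Fin n) : AmbIdx n := Sum.inr (Sum.inl A)
def ip {n : ℕ} (A : Fin n) : AmbIdx n := Sum.inr (Sum.inr (Sum.inl A))
def irho (n : ℕ) : AmbIdx n := Sum.inr (Sum.inr (Sum.inr ()))

/-- The `x`-coordinates of an ambient point. -/
def xc {n : ℕ} (u : AmbIdx n → ℝ) : Fin n → ℝ := fun A => u (ix A)

/-- The ambient metric of the affine connection `Γ`. -/
noncomputable def ambientMetric (n : ℕ) (Γ : Fin n → Fin n → Fin n → (Fin n → ℝ) → ℝ)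
    (u : AmbIdx n → ℝ) : Matrix (AmbIdx n) (AmbIdx n) ℝ :=
  Matrix.of fun a b =>
    match a, b with
    | Sum.inl _, Sum.inl _ => 2 * u (irho n)
    | Sum.inl _, Sum.inr (Sum.inr (Sum.inr _)) => u (it n)
    | Sum.inr (Sum.inr (Sum.inr _)), Sum.inl _ => u (it n)
    | Sum.inr (Sum.inl A), Sum.inr (Sum.inr (Sum.inl B)) =>
        (u (it n))^2 * (if A = B then (1:ℝ) else 0)
    | Sum.inr (Sum.inr (Sum.inl A)), Sum.inr (Sum.inl B) =>
        (u (it n))^2 * (if A = B then (1:ℝ) else 0)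
    | Sum.inr (Sum.inl A), Sum.inr (Sum.inl B) =>
        (u (it n))^2 * (-2 * ∑ C, u (ip C) * Γ C A B (xc u)
          + (2 * u (irho n) / ((n:ℝ) - 1)) * ricConn Γ A B (xc u))
    | _, _ => 0

/-- The Patterson–Walker metric of a torsion-free affine connection with
coefficients `Γ`, on the doubled space with coordinates `(x, y)`. -/
noncomputable def pwGen {ι : Type} [Fintype ι] [DecidableEq ι]
    (Γ : ι → ι → ι → (ι → ℝ) → ℝ) (u : (ι ⊕ ι) → ℝ) : Matrix (ι ⊕ ι) (ι ⊕ ι) ℝ :=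
  Matrix.of fun a b =>
    match a, b with
    | Sum.inl i, Sum.inl j => -2 * ∑ k, u (Sum.inr k) * Γ k i j (fun l => u (Sum.inl l))
    | Sum.inl i, Sum.inr j => if i = j then (1:ℝ) else 0
    | Sum.inr i, Sum.inl j => if i = j then (1:ℝ) else 0
    | Sum.inr _, Sum.inr _ => 0

/-- `D` preserves a volume form: there is a smooth positive `v` with
`∑_C Γ^C_{AC} = ∂_A (log v)`. -/
def PreservesVolume (n : ℕ) (Γ : Fin n → Fin n → Fin n → (Fin n → ℝ) → ℝ) : Prop :=
  ∃ v : (Fin n → ℝ) → ℝ, ContDiff ℝ (⊤ : ℕ∞) v ∧ (∀ x, 0 < v x) ∧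
    ∀ (A : Fin n) (x : Fin n → ℝ), (∑ C, Γ C A C x) = pd A (fun y => Real.log (v y)) x

/-- Index type for the Thomas cone: `x^0` and `x^A`. -/
abbrev ThIdx (n : ℕ) : Type := Unit ⊕ Fin n

/-- The Thomas cone connection of the affine connection `Γ`. -/
noncomputable def thomasConn (n : ℕ) (Γ : Fin n → Fin n → Fin n → (Fin n → ℝ) → ℝ) :
    ThIdx n → ThIdx n → ThIdx n → ((ThIdx n) → ℝ) → ℝ := fun c a b u =>
  match c, a, b with
  | Sum.inr C, Sum.inr A, Sum.inr B => Γ C A B (fun E => u (Sum.inr E))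
  | Sum.inl _, Sum.inr A, Sum.inr B =>
      -(u (Sum.inl ()) / ((n:ℝ) - 1)) * ricConn Γ A B (fun E => u (Sum.inr E))
  | Sum.inr B, Sum.inr A, Sum.inl _ => if A = B then 1 / u (Sum.inl ()) else 0
  | Sum.inr B, Sum.inl _, Sum.inr A => if A = B then 1 / u (Sum.inl ()) else 0
  | _, _, _ => 0

/-- The vector field `𝐤 = 2 p_A ∂_{p_A} + 2 ρ ∂_ρ` on the ambient space. -/
noncomputable def ambientHomothety (n : ℕ) : AmbIdx n → (AmbIdx n → ℝ) → ℝ := fun k w =>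
  match k with
  | Sum.inr (Sum.inr (Sum.inl A)) => 2 * w (ip A)
  | Sum.inr (Sum.inr (Sum.inr _)) => 2 * w (irho n)
  | _ => 0

/-- A partial derivative of a smooth function is smooth. -/
lemma contDiff_pd {ι : Type} [Fintype ι] [DecidableEq ι] (i : ι) {f : (ι → ℝ) → ℝ}
    (hf : ContDiff ℝ (⊤ : ℕ∞) f) : ContDiff ℝ (⊤ : ℕ∞) (pd i f) :=
  (hf.fderiv_right (m := (⊤ : ℕ∞)) (by simp)).clm_apply contDiff_const

/-- The Ricci curvature of a smooth connection is smooth. -/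
lemma contDiff_ricConn {ι : Type} [Fintype ι] [DecidableEq ι]
    {Γ : ι → ι → ι → (ι → ℝ) → ℝ} (hΓ : ∀ k i j, ContDiff ℝ (⊤ : ℕ∞) (Γ k i j)) (i j : ι) :
    ContDiff ℝ (⊤ : ℕ∞) (ricConn Γ i j) := by
  refine ((ContDiff.sum fun k _ => contDiff_pd k (hΓ k i j)).sub
    (ContDiff.sum fun k _ => contDiff_pd i (hΓ k k j))).add
    (ContDiff.sum fun k _ => ContDiff.sum fun l _ => ?_)
  exact ((hΓ k k l).mul (hΓ l i j)).sub ((hΓ k i l).mul (hΓ l k j))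

/-- The derivative of a function along a vector, in coordinates. -/
lemma sum_mul_pd {ι : Type} [Fintype ι] [DecidableEq ι] (v : ι → ℝ) (f : (ι → ℝ) → ℝ)
    (x : ι → ℝ) : ∑ k, v k * pd k f x = fderiv ℝ f x v := by
  conv_rhs => rw [← Finset.univ_sum_single v, map_sum]
  refine Finset.sum_congr rfl fun k _ => ?_
  rw [pd, ← smul_eq_mul, ← map_smul, ← Pi.single_smul, smul_eq_mul, mul_one]

lemma pd_const_mul_coord {ι : Type} [Fintype ι] [DecidableEq ι] (c : ℝ) (i k : ι) (x : ι → ℝ) :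
    pd i (fun y => c * y k) x = if k = i then c else 0 := by
  have h : HasFDerivAt (fun y : ι → ℝ => c * y k)
      (c • (ContinuousLinearMap.proj k : (ι → ℝ) →L[ℝ] ℝ)) x :=
    (hasFDerivAt_apply k x).const_mul c
  simp [pd, h.fderiv, Pi.single_apply]

/-- The Lie derivative of a metric along a diagonal linear vector field. -/
lemma lieDeriv_diagonal {ι : Type} [Fintype ι] [DecidableEq ι] (w : ι → ℝ)
    (G : (ι → ℝ) → Matrix ι ι ℝ) (i j : ι) (x : ι → ℝ) :
    lieDeriv (fun k y => w k * y k) G i j x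
      = fderiv ℝ (fun y => G y i j) x (fun k => w k * x k) + (w i + w j) * G x i j := by
  simp only [lieDeriv, pd_const_mul_coord, ite_mul, zero_mul, Finset.sum_ite_eq',
    Finset.mem_univ, if_true]
  rw [← sum_mul_pd]
  ring

/-- A differentiable function that is affine along a line has the evident derivative along it. -/
lemma fderiv_apply_of_affine_on_line {E : Type*} [NormedAddCommGroup E] [NormedSpace ℝ E]
    {f : E → ℝ} {x v : E} {c : ℝ} (hf : DifferentiableAt ℝ f x)
    (h : ∀ s : ℝ, f (x + s • v) = f x + s * c) : fderiv ℝ f x v = c := by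
  rw [← hf.lineDeriv_eq_fderiv, lineDeriv]
  simp [h]

/-- The weight of each ambient coordinate under the homothety. -/
def ambientWeight (n : ℕ) : AmbIdx n → ℝ
  | Sum.inr (Sum.inr _) => 2
  | _ => 0

lemma ambientHomothety_eq (n : ℕ) :
    ambientHomothety n = fun k w => ambientWeight n k * w k := by
  funext k w
  rcases k with _ | _ | _ | _ <;> simp [ambientHomothety, ambientWeight, ip, irho]

lemma differentiable_ambientMetric {n : ℕ} {Γ : Fin n → Fin n → Fin n → (Fin n → ℝ) → ℝ}
    (hΓ : ∀ C A B, ContDiff ℝ (⊤ : ℕ∞) (Γ C A B)) (i j : AmbIdx n) :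
    Differentiable ℝ (fun u => ambientMetric n Γ u i j) := by
  have hx : Differentiable ℝ (xc : (AmbIdx n → ℝ) → Fin n → ℝ) := by
    unfold xc; fun_prop
  have hG (C A B : Fin n) : Differentiable ℝ (fun u : AmbIdx n → ℝ => Γ C A B (xc u)) :=
    ((hΓ C A B).differentiable (by simp)).comp hx
  have hR (A B : Fin n) : Differentiable ℝ (fun u : AmbIdx n → ℝ => ricConn Γ A B (xc u)) :=
    ((contDiff_ricConn hΓ A B).differentiable (by simp)).comp hx
  have hxx (A B : Fin n) :
      Differentiable ℝ (fun u => ambientMetric n Γ u (Sum.inr (Sum.inl A)) (Sum.inr (Sum.inl B))) :=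
    Differentiable.mul (by fun_prop) <| Differentiable.add
      (Differentiable.const_mul
        (Differentiable.fun_sum fun C _ => Differentiable.mul (by fun_prop) (hG C A B)) _)
      (Differentiable.mul (by fun_prop) (hR A B))
  rcases i with _ | A | _ | _ <;> rcases j with _ | B | _ | _
  case inr.inl.inr.inl => exact hxx A B
  all_goals simp only [ambientMetric, Matrix.of_apply]; fun_prop

/-- Each entry of the ambient metric is affine along the homothety. -/
lemma ambientMetric_add_smul (n : ℕ) (Γ : Fin n → Fin n → Fin n → (Fin n → ℝ) → ℝ)
    (u : AmbIdx n → ℝ) (i j : AmbIdx n) (s : ℝ) :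
    ambientMetric n Γ (u + s • fun k => ambientWeight n k * u k) i j
      = ambientMetric n Γ u i j
        + s * ((2 - (ambientWeight n i + ambientWeight n j)) * ambientMetric n Γ u i j) := by
  have hx : xc (u + s • fun k => ambientWeight n k * u k) = xc u := by
    funext A; simp [xc, ix, ambientWeight]
  have ht : (u + s • fun k => ambientWeight n k * u k) (it n) = u (it n) := by
    simp [it, ambientWeight]
  have hρ : (u + s • fun k => ambientWeight n k * u k) (irho n) = (1 + 2 * s) * u (irho n) := by
    simp [irho, ambientWeight]; ring
  have hp (A : Fin n) :
      (u + s • fun k => ambientWeight n k * u k) (ip A) = (1 + 2 * s) * u (ip A) := by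
    simp [ip, ambientWeight]; ring
  generalize (u + s • fun k => ambientWeight n k * u k) = w at hx ht hρ hp ⊢
  rcases i with _ | _ | _ | _ <;> rcases j with _ | _ | _ | _ <;>
    simp only [ambientMetric, Matrix.of_apply, hx, ht, hρ, hp, ambientWeight, mul_assoc,
      ← Finset.mul_sum] <;> ring

/-- `𝐤 = 2 p_A ∂_{p_A} + 2 ρ ∂_ρ` is a homothety of degree `2`
of the ambient metric. -/
theorem ambient_homothety
    (n : ℕ) (hn : 2 ≤ n) (Γ : Fin n → Fin n → Fin n → (Fin n → ℝ) → ℝ)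
    (hsmooth : ∀ C A B, ContDiff ℝ (⊤ : ℕ∞) (Γ C A B))
    (hsym : ∀ C A B x, Γ C A B x = Γ C B A x)
    (hvol : PreservesVolume n Γ) :
    ∀ u : AmbIdx n → ℝ, 0 < u (it n) → ∀ i j : AmbIdx n,
      lieDeriv (ambientHomothety n) (ambientMetric n Γ) i j u
        = 2 * ambientMetric n Γ u i j := by
  intro u _ i j
  rw [ambientHomothety_eq, lieDeriv_diagonal,
    fderiv_apply_of_affine_on_line (differentiable_ambientMetric hsmooth i j u)
      (ambientMetric_add_smul n Γ u i j)]
  ring
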